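/- Let F be a subfield of ℂ, let V be a finite-dimensional F-vector space, let T : V → V be an F-linear endomorphism, and let W be a proper F-subspace of V (W ≠ V). If there exist λ ∈ ℂ and a nonzero vector v in the image of W ⊗_F ℂ inside V ⊗_F ℂ such that (T ⊗ idℂ) v = λ • v, then the characteristic polynomial of T is not irreducible over F. (This is the linear-algebra content of the paper's Lemma 2.1: a proper F-rational subspace of S_k containing an eigenform forces all Hecke polynomials of that weight to be reducible over F.) -/

import Mathlib

open Polynomial in
/-- If the characteristic polynomial of `T` is irreducible, every nonzero functional is a cyclic
vector for the transpose of `T`. -/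
theorem LinearMap.exists_eq_comp_aeval_of_irreducible_charpoly
    {F V : Type*} [Field F] [AddCommGroup V] [Module F V] [FiniteDimensional F V]
    {T : V →ₗ[F] V} (hT : Irreducible T.charpoly) {f : V →ₗ[F] F} (hf : f ≠ 0)
    (g : V →ₗ[F] F) : ∃ q : F[X], g = f ∘ₗ aeval T q := by
  let Φ : degreeLT F (Module.finrank F V) →ₗ[F] (V →ₗ[F] F) :=
    { toFun := fun q => f ∘ₗ aeval T (q : F[X])
      map_add' := fun p q => by simp [LinearMap.comp_add]
      map_smul' := fun c q => by simp [LinearMap.comp_smul] }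
  have hinj : Function.Injective Φ := by
    rw [injective_iff_map_eq_zero]
    rintro ⟨q, hq⟩ (h : f ∘ₗ aeval T q = 0)
    by_contra hne
    have hq0 : q ≠ 0 := fun h0 => hne (Subtype.ext h0)
    have hdeg : q.degree < T.charpoly.degree := by
      rw [degree_eq_natDegree T.charpoly_monic.ne_zero, T.charpoly_natDegree]
      exact mem_degreeLT.mp hq
    obtain ⟨a, b, hab⟩ := hT.coprime_iff_not_dvd.mpr (not_dvd_of_degree_lt hq0 hdeg)
    have h1 : aeval T q * aeval T b = 1 := by
      rw [← map_mul, mul_comm, ← map_one (aeval (R := F) T), ← hab, map_add, map_mul _ a,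
        T.aeval_self_charpoly, mul_zero, zero_add]
    apply hf
    calc f = f ∘ₗ (aeval T q * aeval T b) := by rw [h1]; rfl
      _ = (f ∘ₗ aeval T q) ∘ₗ aeval T b := rfl
      _ = 0 := by rw [h, LinearMap.zero_comp]
  have hfr : Module.finrank F (degreeLT F (Module.finrank F V)) =
      Module.finrank F (V →ₗ[F] F) := by
    rw [(degreeLTEquiv F (Module.finrank F V)).finrank_eq, Module.finrank_fin_fun,
      Module.finrank_linearMap_self]
  have : FiniteDimensional F (degreeLT F (Module.finrank F V)) :=
    (degreeLTEquiv F (Module.finrank F V)).symm.finiteDimensional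
  obtain ⟨q, hq⟩ := (LinearMap.injective_iff_surjective_of_finrank_eq_finrank hfr).mp hinj g
  exact ⟨q, hq.symm⟩

/-- The base changes of the linear functionals on a free module separate points. -/
theorem TensorProduct.eq_zero_of_forall_baseChange_apply_eq_zero
    {R A M : Type*} [CommRing R] [CommRing A] [Algebra R A] [AddCommGroup M] [Module R M]
    [Module.Free R M] {v : TensorProduct R A M}
    (h : ∀ g : M →ₗ[R] R, g.baseChange A v = 0) : v = 0 := by
  let b := Module.Free.chooseBasis R M
  refine (b.baseChange A).ext_elem fun i => ?_
  have key : (b.baseChange A).coord i =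
      (TensorProduct.AlgebraTensorModule.rid R A A).toLinearMap ∘ₗ (b.coord i).baseChange A := by
    ext m
    simp
  have := LinearMap.congr_fun key v
  simpa [h] using this

/-- The base change of a linear map vanishing on `W` vanishes on the base change of `W`. -/
theorem LinearMap.baseChange_apply_eq_zero_of_le_ker
    {R A M N : Type*} [CommRing R] [CommRing A] [Algebra R A] [AddCommGroup M] [Module R M]
    [AddCommGroup N] [Module R N] {f : M →ₗ[R] N} {W : Submodule R M} (hf : W ≤ f.ker)
    {v : TensorProduct R A M} (hv : v ∈ W.baseChange A) : f.baseChange A v = 0 := by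
  suffices W.baseChange A ≤ (f.baseChange A).ker from this hv
  rw [Submodule.baseChange_eq_span, Submodule.span_le]
  rintro _ ⟨w, hw, rfl⟩
  have : f w = 0 := hf hw
  simp [this]

open Polynomial in
/-- Polynomials in `T` act through scalars on an eigenvector of the base change of `T`. -/
theorem LinearMap.baseChange_aeval_apply_of_eigenvector
    {R A M : Type*} [CommRing R] [CommRing A] [Algebra R A] [AddCommGroup M] [Module R M]
    {T : M →ₗ[R] M} {μ : A} {v : TensorProduct R A M} (h : T.baseChange A v = μ • v)
    (q : R[X]) : (aeval T q).baseChange A v = aeval μ q • v := by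
  induction q using Polynomial.induction_on' with
  | add p q hp hq => simp [LinearMap.baseChange_add, hp, hq, add_smul]
  | monomial n a =>
    have hpow : ((T ^ n).baseChange A) v = μ ^ n • v := by
      rw [LinearMap.baseChange_pow]
      induction n with
      | zero => simp
      | succ n ih => rw [pow_succ', Module.End.mul_apply, ih, map_smul, h, smul_smul, pow_succ]
    rw [aeval_monomial, aeval_monomial, ← Algebra.smul_def, ← Algebra.smul_def,
      LinearMap.baseChange_smul, LinearMap.smul_apply, hpow, smul_assoc]

/-- If `W` is a proper `F`-subspace of a finite-dimensional `F`-vector space `V`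
(`F` a subfield of `ℂ`) and the base change of `W` to `ℂ` contains a nonzero
eigenvector of the base-changed endomorphism `T ⊗ idℂ`, then the characteristic
polynomial of `T` is not irreducible over `F`. -/
theorem charpoly_not_irreducible_of_proper_subspace_eigenvector
    (F : Subfield ℂ) (V : Type*) [AddCommGroup V] [Module F V] [FiniteDimensional F V]
    (T : V →ₗ[F] V) (W : Submodule F V) (hW : W ≠ ⊤)
    (lam : ℂ) (v : TensorProduct F ℂ V) (hv : v ∈ W.baseChange ℂ) (hv0 : v ≠ 0)
    (heig : LinearMap.baseChange ℂ T v = lam • v) :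
    ¬ Irreducible (LinearMap.charpoly T) := by
  intro hT
  obtain ⟨f, hf0, hf⟩ := W.exists_le_ker_of_lt_top hW.lt_top
  refine hv0 (TensorProduct.eq_zero_of_forall_baseChange_apply_eq_zero fun g => ?_)
  obtain ⟨q, rfl⟩ := LinearMap.exists_eq_comp_aeval_of_irreducible_charpoly hT hf0 g
  rw [LinearMap.baseChange_comp, LinearMap.comp_apply,
    LinearMap.baseChange_aeval_apply_of_eigenvector heig, map_smul,
    LinearMap.baseChange_apply_eq_zero_of_le_ker hf hv, smul_zero]
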